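/- For all n ∈ ℕ, the n-th twisted power ω^{(n)} := ∏_{k=0}^{n−1}(ω − (k)_{q^p}(q−1)x) in R[ω] satisfies ω^{(n)} = Σ_{k=1}^{n} s_{q^p}(n,k)·(q−1)^{n−k}·x^{n−k}·ω^k for n > 0, and ω^n = Σ_{k=1}^{n} S_{q^p}(n,k)·(q−1)^{n−k}·x^{n−k}·ω^{(k)}. -/

import Mathlib

/-- The twisted integer (q-analog) `(k)_q = 1 + q + ⋯ + q^{k-1}`. -/
def qInt {R : Type*} [CommRing R] (q : R) (n : ℕ) : R := ∑ i ∈ Finset.range n, q ^ i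

/-- Twisted Stirling numbers of the first kind. -/
def sQ {R : Type*} [CommRing R] (q : R) : ℕ → ℕ → R
  | 0, 0 => 1
  | 0, _ + 1 => 0
  | _ + 1, 0 => 0
  | n + 1, k + 1 => sQ q n k - qInt q n * sQ q n (k + 1)

/-- Twisted Stirling numbers of the second kind. -/
def SQ {R : Type*} [CommRing R] (q : R) : ℕ → ℕ → R
  | 0, 0 => 1
  | 0, _ + 1 => 0
  | _ + 1, 0 => 0
  | n + 1, k + 1 => SQ q n k + qInt q (k + 1) * SQ q n (k + 1)

/-- The `n`-th twisted (𝛥-)power `ω^{(n)} = ∏_{k=0}^{n−1}(ω − (k)_{q^p}(q−1)x)` in `R[ω]`. -/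
noncomputable def twPow {R : Type*} [CommRing R] (q x : R) (p : ℕ) (n : ℕ) : Polynomial R :=
  ∏ k ∈ Finset.range n, (Polynomial.X - Polynomial.C (qInt (q ^ p) k * (q - 1) * x))

open Polynomial in
theorem twPow_succ {R : Type*} [CommRing R] (q x : R) (p n : ℕ) :
    twPow q x p (n + 1) = twPow q x p n * (X - C (qInt (q ^ p) n * (q - 1) * x)) :=
  Finset.prod_range_succ _ _

theorem sQ_eq_zero_of_lt {R : Type*} [CommRing R] (q : R) {n k : ℕ} (h : n < k) :
    sQ q n k = 0 := by
  induction n generalizing k with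
  | zero => obtain _ | k := k <;> simp_all [sQ]
  | succ n ih =>
    obtain _ | k := k
    · omega
    · simp [sQ, ih (show n < k by omega), ih (show n < k + 1 by omega)]

theorem SQ_eq_zero_of_lt {R : Type*} [CommRing R] (q : R) {n k : ℕ} (h : n < k) :
    SQ q n k = 0 := by
  induction n generalizing k with
  | zero => obtain _ | k := k <;> simp_all [SQ]
  | succ n ih =>
    obtain _ | k := k
    · omega
    · simp [SQ, ih (show n < k by omega), ih (show n < k + 1 by omega)]

theorem qInt_mul_sQ_zero {R : Type*} [CommRing R] (q : R) (n : ℕ) :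
    qInt q n * sQ q n 0 = 0 := by
  cases n <;> simp [qInt, sQ]

theorem sum_range_shift_eq {M : Type*} [AddCommGroup M] (f : ℕ → M) {n : ℕ} (h : f 0 = f n) :
    ∑ k ∈ Finset.range n, f (k + 1) = ∑ k ∈ Finset.range n, f k := by
  rw [← sub_eq_zero, ← Finset.sum_sub_distrib, Finset.sum_range_sub, h, sub_self]

theorem sum_Icc_one_eq_sum_range_succ {M : Type*} [AddCommMonoid M] (f : ℕ → M) (n : ℕ)
    (h : f 0 = 0) : ∑ k ∈ Finset.Icc 1 n, f k = ∑ k ∈ Finset.range (n + 1), f k := by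
  rw [Finset.sum_range_succ', h, add_zero, Finset.range_eq_Ico, Finset.sum_Ico_add' f 0 n 1]
  rfl

open Polynomial in
theorem twPow_eq_sum_sQ {R : Type*} [CommRing R] (q x : R) (p n : ℕ) :
    twPow q x p n = ∑ k ∈ Finset.range (n + 1),
      C (sQ (q ^ p) n k * (q - 1) ^ (n - k) * x ^ (n - k)) * X ^ k := by
  induction n with
  | zero => simp [twPow, sQ]
  | succ n ih =>
    have key := sum_range_shift_eq (n := n + 1) (fun k =>
      C (qInt (q ^ p) n * sQ (q ^ p) n k * (q - 1) ^ (n + 1 - k) * x ^ (n + 1 - k)) * X ^ k)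
      (by simp [qInt_mul_sQ_zero, sQ_eq_zero_of_lt])
    rw [twPow_succ, ih, Finset.sum_mul, Finset.sum_range_succ' _ (n + 1)]
    simp only [sQ, zero_mul, C_0, add_zero, Nat.add_sub_add_right] at key ⊢
    simp only [sub_mul, mul_assoc, C_sub, Finset.sum_sub_distrib] at key ⊢
    rw [key, ← Finset.sum_sub_distrib]
    refine Finset.sum_congr rfl fun k hk => ?_
    rw [Nat.succ_sub (Nat.lt_succ_iff.mp (Finset.mem_range.mp hk))]
    simp only [C_mul, C_pow, C_sub, C_1, Nat.succ_eq_add_one]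
    ring

open Polynomial in
theorem X_pow_eq_sum_SQ {R : Type*} [CommRing R] (q x : R) (p n : ℕ) :
    (X : R[X]) ^ n = ∑ k ∈ Finset.range (n + 1),
      C (SQ (q ^ p) n k * (q - 1) ^ (n - k) * x ^ (n - k)) * twPow q x p k := by
  induction n with
  | zero => simp [twPow, SQ]
  | succ n ih =>
    have key := sum_range_shift_eq (n := n + 1) (fun k =>
      C (qInt (q ^ p) k * SQ (q ^ p) n k * (q - 1) ^ (n + 1 - k) * x ^ (n + 1 - k)) *
        twPow q x p k)
      (by simp [qInt, SQ_eq_zero_of_lt])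
    rw [pow_succ, ih, Finset.sum_mul, Finset.sum_range_succ' _ (n + 1)]
    simp only [SQ, zero_mul, C_0, add_zero, Nat.add_sub_add_right] at key ⊢
    simp only [add_mul, mul_assoc, C_add, Finset.sum_add_distrib] at key ⊢
    rw [key, ← Finset.sum_add_distrib]
    refine Finset.sum_congr rfl fun k hk => ?_
    rw [Nat.succ_sub (Nat.lt_succ_iff.mp (Finset.mem_range.mp hk)), twPow_succ]
    simp only [C_mul, C_pow, C_sub, C_1, Nat.succ_eq_add_one]
    ring

/-- For `n > 0`: `ω^{(n)} = Σ_{k=1}^{n} s_{q^p}(n,k)·(q−1)^{n−k}·x^{n−k}·ω^k` and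
`ω^n = Σ_{k=1}^{n} S_{q^p}(n,k)·(q−1)^{n−k}·x^{n−k}·ω^{(k)}`. -/
theorem stmt3 {R : Type*} [CommRing R] (q x : R) (p : ℕ) (n : ℕ) (hn : 0 < n) :
    twPow q x p n =
      ∑ k ∈ Finset.Icc 1 n,
        Polynomial.C (sQ (q ^ p) n k * (q - 1) ^ (n - k) * x ^ (n - k)) * Polynomial.X ^ k ∧
    (Polynomial.X : Polynomial R) ^ n =
      ∑ k ∈ Finset.Icc 1 n,
        Polynomial.C (SQ (q ^ p) n k * (q - 1) ^ (n - k) * x ^ (n - k)) * twPow q x p k := by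
  obtain ⟨m, rfl⟩ := Nat.exists_eq_add_one.mpr hn
  rw [sum_Icc_one_eq_sum_range_succ _ _ (by simp [sQ]),
    sum_Icc_one_eq_sum_range_succ _ _ (by simp [SQ])]
  exact ⟨twPow_eq_sum_sQ q x p _, X_pow_eq_sum_SQ q x p _⟩
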